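/- Let n ≥ 1 and let P and Q be elements of the n-qubit real Pauli group P_n such that P² = Q² = I, P ≠ ±I, Q ≠ ±I, and P and Q anticommute (PQ = −QP). Then there exists U in the gate group G_n such that U P U⁻¹ = I ⊗ ⋯ ⊗ I ⊗ Z and U Q U⁻¹ = I ⊗ ⋯ ⊗ I ⊗ X (with Z, respectively X, in the last tensor factor and the 2×2 identity in the remaining n−1 factors). -/

import Mathlib

open Matrix

noncomputable section

namespace RealStab

abbrev Mat (n : ℕ) := Matrix (Fin n → Fin 2) (Fin n → Fin 2) ℝ

/-- The real Pauli matrix `X`. -/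
def X2 : Matrix (Fin 2) (Fin 2) ℝ := !![0, 1; 1, 0]

/-- The real Pauli matrix `Z`. -/
def Z2 : Matrix (Fin 2) (Fin 2) ℝ := !![1, 0; 0, -1]

/-- The set `{I, X, Z, XZ}` of single-qubit Pauli matrices. -/
def pauliSet : Set (Matrix (Fin 2) (Fin 2) ℝ) := {1, X2, Z2, X2 * Z2}

/-- The `n`-fold Kronecker (tensor) product `P 0 ⊗ ⋯ ⊗ P (n-1)`, represented as a
matrix indexed by functions `Fin n → Fin 2` (a `2^n × 2^n` matrix). -/
def tensorN {n : ℕ} (P : Fin n → Matrix (Fin 2) (Fin 2) ℝ) : Mat n :=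
  Matrix.of fun x y => ∏ i, P i (x i) (y i)

/-- The `n`-qubit real Pauli group `P_n`, as a set of `2^n × 2^n` real matrices. -/
def PauliGroup (n : ℕ) : Set (Mat n) :=
  { M | ∃ a : Fin 2, ∃ P : Fin n → Matrix (Fin 2) (Fin 2) ℝ,
      (∀ i, P i ∈ pauliSet) ∧ M = (-1 : ℝ) ^ (a : ℕ) • tensorN P }


/-- The Hadamard matrix `H = (1/√2)·!![1,1;1,−1]`. -/
def Hmat : Matrix (Fin 2) (Fin 2) ℝ := (Real.sqrt 2)⁻¹ • !![1, 1; 1, -1]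

/-- The single-qubit gate `G` applied on qubit `i`: the Kronecker product
`I^{⊗(i-1)} ⊗ G ⊗ I^{⊗(n-i)}`. -/
def gate1 {n : ℕ} (i : Fin n) (G : Matrix (Fin 2) (Fin 2) ℝ) : Mat n :=
  tensorN (fun j => if j = i then G else 1)

/-- The controlled-Z gate on qubits `i` and `j`: diagonal, with entry `−1` exactly
on basis states where both bits `i` and `j` equal `1`. For `j = i+1` this is
`I^{⊗(i-1)} ⊗ CZ ⊗ I^{⊗(n-i-1)}` with `CZ = diag(1,1,1,−1)`. -/
def CZgate {n : ℕ} (i j : Fin n) : Mat n :=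
  Matrix.diagonal (fun x => if x i = 1 ∧ x j = 1 then -1 else 1)

/-- The set of generating gate matrices: `H`-gates and `Z`-gates on each qubit, and
`CZ`-gates on adjacent pairs of qubits. -/
def gateSet (n : ℕ) : Set (Mat n) :=
  { M | (∃ i : Fin n, M = gate1 i Hmat) ∨ (∃ i : Fin n, M = gate1 i Z2) ∨
        (∃ i : Fin n, ∃ h : (i : ℕ) + 1 < n, M = CZgate i ⟨(i : ℕ) + 1, h⟩) }

/-- The gate group `G_n`: the subgroup of `GL(2^n, ℝ)` (units of the matrix ring)
generated by all `H`-gates, `Z`-gates and `CZ`-gates. -/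
def GateGroup (n : ℕ) : Subgroup (Mat n)ˣ :=
  Subgroup.closure { U : (Mat n)ˣ | (U : Mat n) ∈ gateSet n }

/-- The extended gate group `G_n'`: the subgroup of `GL(2^n, ℝ)` generated by `−I`
together with all `H`-gates, `Z`-gates and `CZ`-gates. -/
def ExtGateGroup (n : ℕ) : Subgroup (Mat n)ˣ :=
  Subgroup.closure ({ U : (Mat n)ˣ | (U : Mat n) ∈ gateSet n } ∪ {(-1 : (Mat n)ˣ)})

/-- `I ⊗ ⋯ ⊗ I ⊗ X` (X on the last qubit). -/
def lastX (n : ℕ) : Mat n := tensorN (fun j => if (j : ℕ) = n - 1 then X2 else 1)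

/-- `I ⊗ ⋯ ⊗ I ⊗ Z` (Z on the last qubit). -/
def lastZ (n : ℕ) : Mat n := tensorN (fun j => if (j : ℕ) = n - 1 then Z2 else 1)

/-- The single-qubit Pauli matrix `X^a Z^b` with exponents `(a, b)`. -/
def pauli1 (v : ZMod 2 × ZMod 2) : Matrix (Fin 2) (Fin 2) ℝ :=
  X2 ^ v.1.val * Z2 ^ v.2.val

/-- The unsigned Pauli matrix with exponent vector `p`. -/
def pauli {n : ℕ} (p : Fin n → ZMod 2 × ZMod 2) : Mat n :=
  tensorN fun i => pauli1 (p i)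

lemma pauli1_zero_zero : pauli1 (0, 0) = 1 := show X2 ^ 0 * Z2 ^ 0 = 1 by simp

lemma pauli1_zero_one : pauli1 (0, 1) = Z2 := show X2 ^ 0 * Z2 ^ 1 = Z2 by simp

lemma pauli1_one_zero : pauli1 (1, 0) = X2 := show X2 ^ 1 * Z2 ^ 0 = X2 by simp

lemma pauli1_one_one : pauli1 (1, 1) = X2 * Z2 := show X2 ^ 1 * Z2 ^ 1 = X2 * Z2 by simp

lemma eq_zero_or_eq_one (a : ZMod 2) : a = 0 ∨ a = 1 := by
  revert a; decide

lemma tensorN_mul {n : ℕ} (P Q : Fin n → Matrix (Fin 2) (Fin 2) ℝ) :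
    tensorN P * tensorN Q = tensorN fun i => P i * Q i := by
  ext x y
  simp only [tensorN, Matrix.mul_apply, Matrix.of_apply, Finset.prod_univ_sum,
    Fintype.piFinset_univ, Finset.prod_mul_distrib]

lemma tensorN_one {n : ℕ} : tensorN (fun _ : Fin n => (1 : Matrix (Fin 2) (Fin 2) ℝ)) = 1 := by
  ext x y
  simp only [tensorN, Matrix.of_apply, Matrix.one_apply, Finset.prod_ite_zero, funext_iff]
  simp

lemma tensorN_neg_at {n : ℕ} {P Q : Fin n → Matrix (Fin 2) (Fin 2) ℝ} (i : Fin n)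
    (hi : P i = -Q i) (h : ∀ j, j ≠ i → P j = Q j) : tensorN P = -tensorN Q := by
  ext x y
  simp only [tensorN, Matrix.of_apply, Matrix.neg_apply]
  rw [← Finset.mul_prod_erase _ _ (Finset.mem_univ i),
    ← Finset.mul_prod_erase Finset.univ (fun j => Q j (x j) (y j)) (Finset.mem_univ i), hi,
    Finset.prod_congr rfl fun j hj => by rw [h j (Finset.ne_of_mem_erase hj)],
    Matrix.neg_apply, neg_mul]

lemma gate1_mul {n : ℕ} (i : Fin n) (A B : Matrix (Fin 2) (Fin 2) ℝ) :
    gate1 i A * gate1 i B = gate1 i (A * B) := by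
  simp only [gate1, tensorN_mul]
  congr 1
  ext1 j
  split_ifs <;> simp

lemma gate1_one {n : ℕ} (i : Fin n) : gate1 i 1 = 1 := by
  simp [gate1, tensorN_one]

lemma gate1_neg {n : ℕ} (i : Fin n) (A : Matrix (Fin 2) (Fin 2) ℝ) :
    gate1 i (-A) = -gate1 i A :=
  tensorN_neg_at i (by simp) fun j hj => by simp [hj]

lemma Z2_mul_self : Z2 * Z2 = 1 := by
  ext i j; fin_cases i <;> fin_cases j <;> simp [Z2]

lemma Z2_mul_X2 : Z2 * X2 = -(X2 * Z2) := by
  ext i j; fin_cases i <;> fin_cases j <;> simp [X2, Z2]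

lemma sqrt_two_inv_mul_self : (Real.sqrt 2)⁻¹ * (Real.sqrt 2)⁻¹ = 1 / 2 := by
  rw [← mul_inv, Real.mul_self_sqrt (by norm_num)]; norm_num

lemma Hmat_mul_self : Hmat * Hmat = 1 := by
  rw [Hmat, smul_mul_smul_comm, sqrt_two_inv_mul_self]
  ext i j; fin_cases i <;> fin_cases j <;> norm_num

lemma Hmat_mul_Z2_mul_Hmat : Hmat * Z2 * Hmat = X2 := by
  rw [Hmat, smul_mul_assoc, smul_mul_smul_comm, sqrt_two_inv_mul_self]
  ext i j; fin_cases i <;> fin_cases j <;> norm_num [X2, Z2]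

lemma Hmat_mul_X2_mul_Hmat : Hmat * X2 * Hmat = Z2 := by
  rw [← Hmat_mul_Z2_mul_Hmat]
  simp only [← mul_assoc, Hmat_mul_self, one_mul]
  rw [mul_assoc, Hmat_mul_self, mul_one]

lemma Hmat_conj_pauli1 (v : ZMod 2 × ZMod 2) :
    Hmat * pauli1 v * Hmat = pauli1 v.swap ∨ Hmat * pauli1 v * Hmat = -pauli1 v.swap := by
  have hXZ : Hmat * (X2 * Z2) * Hmat = Z2 * X2 := by
    rw [← Hmat_mul_X2_mul_Hmat, ← Hmat_mul_Z2_mul_Hmat]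
    simp only [← mul_assoc, Hmat_mul_self, one_mul]
    simp only [mul_assoc, Hmat_mul_self, mul_one]
  obtain ⟨a, b⟩ := v
  rcases eq_zero_or_eq_one a with rfl | rfl <;> rcases eq_zero_or_eq_one b with rfl | rfl <;>
    simp [pauli1_zero_zero, pauli1_zero_one, pauli1_one_zero, pauli1_one_one, Hmat_mul_self,
      Hmat_mul_Z2_mul_Hmat, Hmat_mul_X2_mul_Hmat, hXZ, Z2_mul_X2]

lemma CZgate_mul_self {n : ℕ} (i j : Fin n) : CZgate i j * CZgate i j = 1 := by
  rw [CZgate, Matrix.diagonal_mul_diagonal, ← Matrix.diagonal_one]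
  congr 1
  ext1 x
  split_ifs <;> simp

/-- The action of the `H`-gate on qubit `i` on exponent vectors. -/
def hadamardMap {n : ℕ} (i : Fin n) (p : Fin n → ZMod 2 × ZMod 2) :
    Fin n → ZMod 2 × ZMod 2 :=
  fun k => if k = i then (p k).swap else p k

/-- The action of the `CZ`-gate on qubits `i` and `j` on exponent vectors. -/
def czMap {n : ℕ} (i j : Fin n) (p : Fin n → ZMod 2 × ZMod 2) : Fin n → ZMod 2 × ZMod 2 :=
  fun k => if k = i then ((p i).1, (p i).2 + (p j).1) else
    if k = j then ((p j).1, (p j).2 + (p i).1) else p k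

/-- A map of exponent vectors is realized if, up to signs, it is conjugation by an element of
the gate group. -/
def Realized {n : ℕ} (f : (Fin n → ZMod 2 × ZMod 2) → Fin n → ZMod 2 × ZMod 2) : Prop :=
  ∃ U ∈ GateGroup n, ∀ p,
    (U : Mat n) * pauli p * ((U⁻¹ : (Mat n)ˣ) : Mat n) = pauli (f p) ∨
      (U : Mat n) * pauli p * ((U⁻¹ : (Mat n)ˣ) : Mat n) = -pauli (f p)

lemma Realized.id {n : ℕ} : Realized (n := n) fun p => p :=
  ⟨1, one_mem _, fun p => by simp⟩

lemma Realized.comp {n : ℕ} {g f : (Fin n → ZMod 2 × ZMod 2) → Fin n → ZMod 2 × ZMod 2}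
    (hg : Realized g) (hf : Realized f) : Realized fun p => g (f p) := by
  obtain ⟨V, hV, hVp⟩ := hg
  obtain ⟨U, hU, hUp⟩ := hf
  refine ⟨V * U, mul_mem hV hU, fun p => ?_⟩
  have h : ((V * U : (Mat n)ˣ) : Mat n) * pauli p * (((V * U)⁻¹ : (Mat n)ˣ) : Mat n) =
      V * (U * pauli p * ((U⁻¹ : (Mat n)ˣ) : Mat n)) * ((V⁻¹ : (Mat n)ˣ) : Mat n) := by
    simp only [_root_.mul_inv_rev, Units.val_mul, mul_assoc]
  rw [h]
  rcases hUp p with h1 | h1 <;> rcases hVp (f p) with h2 | h2 <;>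
    simp only [h1, h2, mul_neg, neg_mul, neg_neg, true_or, or_true]

lemma realized_of_involution {n : ℕ} {A : Mat n} (hA : A ∈ gateSet n) (hAA : A * A = 1)
    {f : (Fin n → ZMod 2 × ZMod 2) → Fin n → ZMod 2 × ZMod 2}
    (h : ∀ p, A * pauli p * A = pauli (f p) ∨ A * pauli p * A = -pauli (f p)) :
    Realized f :=
  ⟨⟨A, A, hAA, hAA⟩, Subgroup.subset_closure hA, h⟩

lemma realized_hadamardMap {n : ℕ} (i : Fin n) : Realized (hadamardMap i) := by
  refine realized_of_involution (Or.inl ⟨i, rfl⟩) (by rw [gate1_mul, Hmat_mul_self, gate1_one])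
    fun p => ?_
  rw [gate1, pauli, tensorN_mul, tensorN_mul]
  rcases Hmat_conj_pauli1 (p i) with h | h
  · left
    rw [pauli]
    congr 1
    ext1 j
    by_cases hj : j = i
    · subst hj; simpa [hadamardMap] using h
    · simp [hadamardMap, hj]
  · right
    exact tensorN_neg_at i (by simpa [hadamardMap] using h)
      fun j hj => by simp [hadamardMap, hj]

lemma pauli1_apply (v : ZMod 2 × ZMod 2) (x y : Fin 2) :
    pauli1 v x y =
      (if v.1 = 0 then (if x = y then 1 else 0) else if x = y then 0 else 1) *
        (if v.2 = 0 ∨ y = 0 then 1 else -1) := by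
  obtain ⟨a, b⟩ := v
  rcases eq_zero_or_eq_one a with rfl | rfl <;> rcases eq_zero_or_eq_one b with rfl | rfl <;>
    fin_cases x <;> fin_cases y <;>
    simp [pauli1_zero_zero, pauli1_zero_one, pauli1_one_zero, pauli1_one_one, X2, Z2]

lemma CZgate_conj_pauli {n : ℕ} {i j : Fin n} (hij : i ≠ j) (p : Fin n → ZMod 2 × ZMod 2) :
    CZgate i j * pauli p * CZgate i j = pauli (czMap i j p) ∨
      CZgate i j * pauli p * CZgate i j = -pauli (czMap i j p) := by
  have hsplit : ∀ (q : Fin n → ZMod 2 × ZMod 2) (x y : Fin n → Fin 2),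
      pauli q x y = pauli1 (q i) (x i) (y i) * (pauli1 (q j) (x j) (y j) *
        ∏ k ∈ (Finset.univ.erase i).erase j, pauli1 (q k) (x k) (y k)) := by
    intro q x y
    rw [Finset.mul_prod_erase _ (fun k => pauli1 (q k) (x k) (y k))
        (Finset.mem_erase.2 ⟨hij.symm, Finset.mem_univ j⟩),
      Finset.mul_prod_erase _ (fun k => pauli1 (q k) (x k) (y k)) (Finset.mem_univ i)]
    rfl
  have hrest : ∀ x y : Fin n → Fin 2,
      ∏ k ∈ (Finset.univ.erase i).erase j, pauli1 (czMap i j p k) (x k) (y k) =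
        ∏ k ∈ (Finset.univ.erase i).erase j, pauli1 (p k) (x k) (y k) := by
    refine fun x y => Finset.prod_congr rfl fun k hk => ?_
    simp only [Finset.mem_erase] at hk
    simp [czMap, hk.1, hk.2.1]
  have hi : czMap i j p i = ((p i).1, (p i).2 + (p j).1) := by simp [czMap]
  have hj : czMap i j p j = ((p j).1, (p j).2 + (p i).1) := by simp [czMap, hij.symm]
  have key : ∀ v w : ZMod 2 × ZMod 2, ∃ s : ℝ, (s = 1 ∨ s = -1) ∧ ∀ a b c d : Fin 2,
      (if a = 1 ∧ b = 1 then (-1 : ℝ) else 1) * (pauli1 v a c * pauli1 w b d) *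
        (if c = 1 ∧ d = 1 then -1 else 1) =
      s * (pauli1 (v.1, v.2 + w.1) a c * pauli1 (w.1, w.2 + v.1) b d) := by
    rintro ⟨v1, v2⟩ ⟨w1, w2⟩
    refine ⟨if v1 = 0 ∨ w1 = 0 then 1 else -1, by split_ifs <;> simp, ?_⟩
    simp only [pauli1_apply]
    have e : (1 : ZMod 2) + 1 = 0 := rfl
    rcases eq_zero_or_eq_one v1 with rfl | rfl <;>
      rcases eq_zero_or_eq_one w1 with rfl | rfl <;>
      rcases eq_zero_or_eq_one v2 with rfl | rfl <;>
      rcases eq_zero_or_eq_one w2 with rfl | rfl <;>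
      simp [Fin.forall_fin_two, e]
  obtain ⟨s, hs, hkey⟩ := key (p i) (p j)
  have hmain : CZgate i j * pauli p * CZgate i j = s • pauli (czMap i j p) := by
    ext x y
    rw [CZgate, Matrix.mul_diagonal, Matrix.diagonal_mul, Matrix.smul_apply, hsplit, hsplit,
      hrest, hi, hj, smul_eq_mul]
    linear_combination (∏ k ∈ (Finset.univ.erase i).erase j, pauli1 (p k) (x k) (y k)) *
      hkey (x i) (x j) (y i) (y j)
  rw [hmain]
  rcases hs with rfl | rfl <;> simp

lemma realized_czMap_adjacent {n : ℕ} (i : Fin n) (h : (i : ℕ) + 1 < n) :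
    Realized (czMap i ⟨(i : ℕ) + 1, h⟩) :=
  realized_of_involution (Or.inr (Or.inr ⟨i, h, rfl⟩)) (CZgate_mul_self _ _)
    (CZgate_conj_pauli (by simp [Fin.ext_iff]))

/-- A swap of two qubits is a product of three controlled-NOT gates. -/
lemma comp_swap_eq {n : ℕ} {i j : Fin n} (hij : i ≠ j) (p : Fin n → ZMod 2 × ZMod 2) :
    p ∘ Equiv.swap i j =
      hadamardMap j (czMap i j (hadamardMap j (hadamardMap i (czMap i j (hadamardMap i
        (hadamardMap j (czMap i j (hadamardMap j p)))))))) := by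
  ext1 k
  by_cases hi : k = i
  · subst hi
    simp only [Function.comp, Equiv.swap_apply_left, hadamardMap, czMap, hij, hij.symm, if_true,
      if_false, Prod.swap]
    generalize p k = v
    generalize p j = w
    revert v w
    decide
  · by_cases hj : k = j
    · subst hj
      simp only [Function.comp, Equiv.swap_apply_right, hadamardMap, czMap, hij, hij.symm,
        if_true, if_false, Prod.swap]
      generalize p k = v
      generalize p i = w
      revert v w
      decide
    · simp [hadamardMap, czMap, hi, hj, Equiv.swap_apply_of_ne_of_ne hi hj]

lemma realized_comp_perm {m : ℕ} (σ : Equiv.Perm (Fin (m + 1))) :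
    Realized fun p => p ∘ σ := by
  have hσ : σ ∈ Submonoid.closure
      (Set.range fun i : Fin m => Equiv.swap i.castSucc i.succ) := by
    rw [Equiv.Perm.mclosure_swap_castSucc_succ]; trivial
  induction hσ using Submonoid.closure_induction with
  | mem τ hτ =>
    obtain ⟨i, rfl⟩ := hτ
    have hij : i.castSucc ≠ i.succ := i.castSucc_lt_succ.ne
    have hcz : Realized (czMap i.castSucc i.succ) :=
      realized_czMap_adjacent i.castSucc (by simp)
    have hH := fun k : Fin (m + 1) => realized_hadamardMap k
    simp only [comp_swap_eq hij]
    exact (hH _).comp (hcz.comp ((hH _).comp ((hH _).comp (hcz.comp ((hH _).comp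
      ((hH _).comp (hcz.comp (hH _))))))))
  | one => exact Realized.id
  | mul σ τ _ _ hσ hτ => exact Realized.comp (g := fun p => p ∘ τ) (f := fun p => p ∘ σ) hτ hσ

lemma realized_czMap_last {m : ℕ} {i : Fin (m + 1)} (hi : i ≠ Fin.last m) :
    Realized (czMap i (Fin.last m)) := by
  obtain _ | m := m
  · exact absurd (Fin.eq_zero i) hi
  set k : Fin (m + 2) := (Fin.last m).castSucc
  have hk : k ≠ Fin.last (m + 1) := (Fin.castSucc_lt_last _).ne
  have hcz : Realized (czMap k (Fin.last (m + 1))) := realized_czMap_adjacent k (by simp [k])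
  have h := (realized_comp_perm (Equiv.swap i k)).comp
    (hcz.comp (realized_comp_perm (Equiv.swap i k)))
  convert h using 1
  ext1 p
  ext1 l
  have hL := Equiv.swap_apply_of_ne_of_ne hi.symm hk.symm
  have h1 : Equiv.swap i k l = k ↔ l = i := by
    rw [← Equiv.eq_symm_apply]; simp
  have h2 : Equiv.swap i k l = Fin.last (m + 1) ↔ l = Fin.last (m + 1) := by
    rw [← Equiv.eq_symm_apply]; simp [hL]
  simp [czMap, h1, h2, hL]

/-- With an `X` on the last qubit, any other qubit can be cleared of its `Z`-part without
changing the Pauli matrix `Z` on the last qubit. -/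
lemma exists_realized_clear_snd {m : ℕ} {i : Fin (m + 1)} (hi : i ≠ Fin.last m)
    {p : Fin (m + 1) → ZMod 2 × ZMod 2} (hp : (p (Fin.last m)).1 = 1) :
    ∃ f, Realized f ∧ f (Pi.single (Fin.last m) (0, 1)) = Pi.single (Fin.last m) (0, 1) ∧
      (f p (Fin.last m)).1 = 1 ∧ f p i = ((p i).1, 0) ∧
      ∀ k, k ≠ i → k ≠ Fin.last m → f p k = p k := by
  by_cases h : (p i).2 = 0
  · exact ⟨_, Realized.id, rfl, hp, Prod.ext rfl h, fun _ _ _ => rfl⟩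
  · have h1 : (p i).2 = 1 := (eq_zero_or_eq_one _).resolve_left h
    refine ⟨_, realized_czMap_last hi, ?_, ?_, ?_, ?_⟩
    · ext1 k
      by_cases hk : k = i
      · subst hk; simp [czMap, Pi.single_eq_of_ne hi]
      · by_cases hl : k = Fin.last m
        · subst hl; simp [czMap, hi.symm]
        · simp [czMap, hk, hl]
    · simpa [czMap, hi.symm] using hp
    · simp only [czMap, if_true, hp, h1]; rfl
    · intro k hk hl
      simp [czMap, hk, hl]

lemma hadamardMap_single_of_ne {n : ℕ} {i j : Fin n} (hij : i ≠ j) (v : ZMod 2 × ZMod 2) :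
    hadamardMap i (Pi.single j v) = Pi.single j v := by
  ext1 k
  by_cases hk : k = i
  · subst hk; simp [hadamardMap, Pi.single_eq_of_ne hij]
  · simp [hadamardMap, hk]

lemma exists_realized_clear {m : ℕ} {i : Fin (m + 1)} (hi : i ≠ Fin.last m)
    {p : Fin (m + 1) → ZMod 2 × ZMod 2} (hp : (p (Fin.last m)).1 = 1) :
    ∃ f, Realized f ∧ f (Pi.single (Fin.last m) (0, 1)) = Pi.single (Fin.last m) (0, 1) ∧
      (f p (Fin.last m)).1 = 1 ∧ f p i = 0 ∧
      ∀ k, k ≠ i → k ≠ Fin.last m → f p k = p k := by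
  obtain ⟨f, hf, hfZ, hf1, hfi, hfk⟩ := exists_realized_clear_snd hi hp
  obtain ⟨g, hg, hgZ, hg1, hgi, hgk⟩ := exists_realized_clear_snd hi
    (p := hadamardMap i (f p)) (by simpa [hadamardMap, hi.symm] using hf1)
  refine ⟨_, hg.comp ((realized_hadamardMap i).comp hf), ?_, hg1, ?_, ?_⟩
  · simp only [hfZ, hadamardMap_single_of_ne hi, hgZ]
  · simp only [hgi, hadamardMap, if_true, hfi]; rfl
  · intro k hk hl
    simp only [hgk k hk hl, hadamardMap, hk, if_false, hfk k hk hl]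

lemma exists_realized_eq_single {m : ℕ} {p : Fin (m + 1) → ZMod 2 × ZMod 2}
    (hp : (p (Fin.last m)).1 = 1) :
    ∃ f, Realized f ∧ f (Pi.single (Fin.last m) (0, 1)) = Pi.single (Fin.last m) (0, 1) ∧
      ∃ c, f p = Pi.single (Fin.last m) (1, c) := by
  have key : ∀ S : Finset (Fin (m + 1)), ∃ f, Realized f ∧
      f (Pi.single (Fin.last m) (0, 1)) = Pi.single (Fin.last m) (0, 1) ∧
      (f p (Fin.last m)).1 = 1 ∧ ∀ k ∈ S, k ≠ Fin.last m → f p k = 0 := by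
    intro S
    induction S using Finset.induction_on with
    | empty => exact ⟨_, Realized.id, rfl, hp, by simp⟩
    | insert i S _ ih =>
      obtain ⟨f, hf, hfZ, hf1, hfk⟩ := ih
      by_cases hi : i = Fin.last m
      · refine ⟨f, hf, hfZ, hf1, fun k hk hl => hfk k ?_ hl⟩
        exact (Finset.mem_insert.1 hk).resolve_left fun h => hl (h.trans hi)
      · obtain ⟨g, hg, hgZ, hg1, hgi, hgk⟩ := exists_realized_clear hi hf1
        refine ⟨_, hg.comp hf, by simp only [hfZ, hgZ], hg1, fun k hk hl => ?_⟩
        by_cases hki : k = i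
        · exact hki ▸ hgi
        · rw [hgk k hki hl]
          exact hfk k ((Finset.mem_insert.1 hk).resolve_left hki) hl
  obtain ⟨f, hf, hfZ, hf1, hfk⟩ := key Finset.univ
  refine ⟨f, hf, hfZ, (f p (Fin.last m)).2, ?_⟩
  ext1 k
  by_cases hk : k = Fin.last m
  · subst hk; rw [Pi.single_eq_same, ← hf1]
  · rw [hfk k (Finset.mem_univ _) hk, Pi.single_eq_of_ne hk]

/-- A nonzero exponent vector can be moved to one supported on the last qubit. -/
lemma exists_realized_eq_single_of_ne_zero {m : ℕ} {p : Fin (m + 1) → ZMod 2 × ZMod 2}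
    (hp : p ≠ 0) : ∃ f, Realized f ∧ ∃ c, f p = Pi.single (Fin.last m) (1, c) := by
  obtain ⟨i, hi⟩ := Function.ne_iff.1 hp
  have hswap := realized_comp_perm (Equiv.swap (Fin.last m) i)
  have hv : ∀ v : ZMod 2 × ZMod 2, v ≠ 0 → v.1 = 1 ∨ v.swap.1 = 1 := by decide
  rcases hv _ hi with h | h
  · obtain ⟨f, hf, -, c, hc⟩ := exists_realized_eq_single
      (p := p ∘ Equiv.swap (Fin.last m) i) (by simpa using h)
    exact ⟨_, hf.comp hswap, c, hc⟩
  · obtain ⟨f, hf, -, c, hc⟩ := exists_realized_eq_single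
      (p := hadamardMap (Fin.last m) (p ∘ Equiv.swap (Fin.last m) i))
      (by simpa [hadamardMap] using h)
    exact ⟨_, hf.comp ((realized_hadamardMap _).comp hswap), c, hc⟩

lemma pauli_zero {n : ℕ} : pauli (0 : Fin n → ZMod 2 × ZMod 2) = 1 := by
  simp [pauli, pauli1, tensorN_one]

lemma pauli_single {n : ℕ} (i : Fin n) (v : ZMod 2 × ZMod 2) :
    pauli (Pi.single i v) = gate1 i (pauli1 v) := by
  rw [pauli, gate1]
  congr 1
  ext1 j
  by_cases hj : j = i
  · subst hj; simp
  · simp [hj, pauli1]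

lemma lastX_eq (m : ℕ) : lastX (m + 1) = gate1 (Fin.last m) X2 := by
  simp [lastX, gate1, Fin.ext_iff]

lemma lastZ_eq (m : ℕ) : lastZ (m + 1) = gate1 (Fin.last m) Z2 := by
  simp [lastZ, gate1, Fin.ext_iff]

lemma exists_eq_pauli_of_mem {n : ℕ} {M : Mat n} (hM : M ∈ PauliGroup n) :
    ∃ p, M = pauli p ∨ M = -pauli p := by
  obtain ⟨a, P, hP, rfl⟩ := hM
  have h : ∀ i, ∃ v, P i = pauli1 v := by
    intro i
    rcases hP i with h | h | h | h <;> rw [h]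
    · exact ⟨(0, 0), pauli1_zero_zero.symm⟩
    · exact ⟨(1, 0), pauli1_one_zero.symm⟩
    · exact ⟨(0, 1), pauli1_zero_one.symm⟩
    · exact ⟨(1, 1), pauli1_one_one.symm⟩
  choose p hp using h
  refine ⟨p, ?_⟩
  rw [show P = fun i => pauli1 (p i) from funext hp]
  fin_cases a <;> simp [pauli]

lemma Realized.exists_conj {n : ℕ}
    {f : (Fin n → ZMod 2 × ZMod 2) → Fin n → ZMod 2 × ZMod 2} (hf : Realized f) :
    ∃ U ∈ GateGroup n, ∀ M p, M = pauli p ∨ M = -pauli p →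
      (U : Mat n) * M * ((U⁻¹ : (Mat n)ˣ) : Mat n) = pauli (f p) ∨
        (U : Mat n) * M * ((U⁻¹ : (Mat n)ˣ) : Mat n) = -pauli (f p) := by
  obtain ⟨U, hU, h⟩ := hf
  refine ⟨U, hU, ?_⟩
  rintro M p (rfl | rfl)
  · exact h p
  · rcases h p with h | h <;>
      simp only [h, mul_neg, neg_mul, neg_neg, true_or, or_true]

lemma eq_zero_of_eq_neg_self {n : ℕ} {A : Mat n} (h : A = -A) : A = 0 := by
  ext x y
  have := congr_fun₂ h x y
  simp only [Matrix.neg_apply] at this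
  simp only [Matrix.zero_apply]
  linarith

lemma mul_ne_mul_of_anticommute {n : ℕ} {A B : Mat n} (hA : A * A = 1) (hB : B * B = 1)
    (h : A * B = -(B * A)) : B * A ≠ A * B := by
  intro hcomm
  have h0 : A * B = 0 := eq_zero_of_eq_neg_self (h.trans (by rw [hcomm]))
  have h1 : A * (A * B) * B = 1 := by rw [← mul_assoc A A B, hA, one_mul, hB]
  rw [h0, mul_zero, zero_mul] at h1
  exact zero_ne_one h1

lemma eq_zero_of_pauli_single_sq {n : ℕ} {i : Fin n} {c : ZMod 2} {M : Mat n}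
    (hM : M = pauli (Pi.single i (1, c)) ∨ M = -pauli (Pi.single i (1, c))) (h : M * M = 1) :
    c = 0 := by
  by_contra hc
  have hc1 : c = 1 := (eq_zero_or_eq_one c).resolve_left hc
  have hXZ : pauli1 (1, 1) * pauli1 (1, 1) = -1 := by
    ext i j; fin_cases i <;> fin_cases j <;> simp [pauli1_one_one, X2, Z2]
  subst hc1
  have h2 : M * M = -1 := by
    rcases hM with rfl | rfl <;>
      simp only [neg_mul_neg, pauli_single, gate1_mul, hXZ, gate1_neg, gate1_one]
  exact one_ne_zero (eq_zero_of_eq_neg_self (h.symm.trans h2))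

lemma pauli_commute_single {n : ℕ} {i : Fin n} {q : Fin n → ZMod 2 × ZMod 2}
    (hq : (q i).1 = 0) : pauli q * pauli (Pi.single i (0, 1)) =
      pauli (Pi.single i (0, 1)) * pauli q := by
  rw [pauli, pauli, tensorN_mul, tensorN_mul]
  congr 1
  ext1 j
  by_cases hj : j = i
  · subst hj
    simp only [pauli1, Pi.single_eq_same, hq, ZMod.val_zero, pow_zero, one_mul]
    exact ((Commute.refl Z2).pow_pow _ _).eq
  · simp [hj, pauli1]

lemma exists_mem_gateGroup_val_gate1_Z2 {n : ℕ} (i : Fin n) :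
    ∃ U ∈ GateGroup n, (U : Mat n) = gate1 i Z2 :=
  ⟨⟨gate1 i Z2, gate1 i Z2, by rw [gate1_mul, Z2_mul_self, gate1_one],
    by rw [gate1_mul, Z2_mul_self, gate1_one]⟩,
    Subgroup.subset_closure (Or.inr (Or.inl ⟨i, rfl⟩)), rfl⟩

lemma exists_mem_gateGroup_val_gate1_X2 {n : ℕ} (i : Fin n) :
    ∃ U ∈ GateGroup n, (U : Mat n) = gate1 i X2 := by
  obtain ⟨U, hU, hUv⟩ := exists_mem_gateGroup_val_gate1_Z2 i
  have hHH : gate1 i Hmat * gate1 i Hmat = 1 := by rw [gate1_mul, Hmat_mul_self, gate1_one]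
  have hV : (⟨gate1 i Hmat, gate1 i Hmat, hHH, hHH⟩ : (Mat n)ˣ) ∈ GateGroup n :=
    Subgroup.subset_closure (Or.inl ⟨i, rfl⟩)
  refine ⟨_, mul_mem (mul_mem hV hU) hV, ?_⟩
  simp only [Units.val_mul, hUv, gate1_mul, Hmat_mul_Z2_mul_Hmat]

/-- The signs of the Pauli matrices `Z` and `X` on one qubit can be corrected independently. -/
lemma exists_conj_fix_signs {n : ℕ} (i : Fin n) {A B : Mat n}
    (hA : A = gate1 i Z2 ∨ A = -gate1 i Z2) (hB : B = gate1 i X2 ∨ B = -gate1 i X2) :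
    ∃ U ∈ GateGroup n, (U : Mat n) * A * ((U⁻¹ : (Mat n)ˣ) : Mat n) = gate1 i Z2 ∧
      (U : Mat n) * B * ((U⁻¹ : (Mat n)ˣ) : Mat n) = gate1 i X2 := by
  obtain ⟨S, hS, hSv⟩ := exists_mem_gateGroup_val_gate1_X2 i
  obtain ⟨T, hT, hTv⟩ := exists_mem_gateGroup_val_gate1_Z2 i
  have hZX : gate1 i Z2 * gate1 i X2 = -(gate1 i X2 * gate1 i Z2) := by
    rw [gate1_mul, gate1_mul, Z2_mul_X2, gate1_neg]
  simp only [Units.mul_inv_eq_iff_eq_mul]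
  rcases hA with rfl | rfl <;> rcases hB with rfl | rfl
  · exact ⟨1, one_mem _, by simp, by simp⟩
  · exact ⟨T, hT, by rw [hTv], by rw [hTv, mul_neg, hZX, neg_neg]⟩
  · exact ⟨S, hS, by rw [hSv, mul_neg, hZX], by rw [hSv]⟩
  · refine ⟨S * T, mul_mem hS hT, ?_, ?_⟩
    · rw [Units.val_mul, hSv, hTv, ← mul_assoc, hZX, mul_neg, neg_mul]
    · rw [Units.val_mul, hSv, hTv, mul_neg, mul_assoc, hZX, mul_neg, neg_neg]

/-- For `n ≥ 1` and anticommuting `P, Q ∈ P_n` with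
`P² = Q² = I` and `P, Q ≠ ±I`, there is `U` in the gate group `G_n` with
`U P U⁻¹ = I ⊗ ⋯ ⊗ I ⊗ Z` and `U Q U⁻¹ = I ⊗ ⋯ ⊗ I ⊗ X`. -/
theorem exists_gate_conj_pair (n : ℕ) (hn : 1 ≤ n) (P Q : Mat n)
    (hP : P ∈ PauliGroup n) (hQ : Q ∈ PauliGroup n)
    (hP2 : P * P = 1) (hQ2 : Q * Q = 1)
    (hP1 : P ≠ 1) (hPm1 : P ≠ -1) (hQ1 : Q ≠ 1) (hQm1 : Q ≠ -1)
    (hanti : P * Q = -(Q * P)) :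
    ∃ U ∈ GateGroup n,
      (U : Mat n) * P * ((U⁻¹ : (Mat n)ˣ) : Mat n) = lastZ n ∧
      (U : Mat n) * Q * ((U⁻¹ : (Mat n)ˣ) : Mat n) = lastX n := by
  obtain ⟨m, rfl⟩ : ∃ m, n = m + 1 := ⟨n - 1, by omega⟩
  obtain ⟨p, hp⟩ := exists_eq_pauli_of_mem hP
  obtain ⟨q, hq⟩ := exists_eq_pauli_of_mem hQ
  have hp0 : p ≠ 0 := by
    rintro rfl
    rw [pauli_zero] at hp
    exact hp.elim hP1 hPm1
  have hsq : ∀ (U : (Mat (m + 1))ˣ) (M N : Mat (m + 1)),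
      ((U : Mat (m + 1)) * M * ((U⁻¹ : (Mat (m + 1))ˣ) : Mat (m + 1))) *
        ((U : Mat (m + 1)) * N * ((U⁻¹ : (Mat (m + 1))ˣ) : Mat (m + 1))) =
      (U : Mat (m + 1)) * (M * N) * ((U⁻¹ : (Mat (m + 1))ˣ) : Mat (m + 1)) := by
    intro U M N
    simp only [mul_assoc, Units.inv_mul_cancel_left]
  obtain ⟨f, hf, c, hc⟩ := exists_realized_eq_single_of_ne_zero hp0
  have hc0 : c = 0 := by
    obtain ⟨U, -, hU⟩ := hf.exists_conj
    have h := hU P p hp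
    rw [hc] at h
    exact eq_zero_of_pauli_single_sq h (by rw [hsq, hP2]; simp)
  subst hc0
  have hfp : hadamardMap (Fin.last m) (f p) = Pi.single (Fin.last m) (0, 1) := by
    ext1 k
    by_cases hk : k = Fin.last m
    · subst hk; simp [hadamardMap, hc]
    · simp [hadamardMap, hc, hk]
  obtain ⟨U, hU, hUp⟩ := ((realized_hadamardMap (Fin.last m)).comp hf).exists_conj
  have hP' := hUp P p hp
  have hQ' := hUp Q q hq
  simp only [hfp] at hP'
  set r := hadamardMap (Fin.last m) (f q)
  set P' := (U : Mat (m + 1)) * P * ((U⁻¹ : (Mat (m + 1))ˣ) : Mat (m + 1)) with hP'def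
  set Q' := (U : Mat (m + 1)) * Q * ((U⁻¹ : (Mat (m + 1))ˣ) : Mat (m + 1)) with hQ'def
  have hP2' : P' * P' = 1 := by rw [hsq, hP2]; simp
  have hQ2' : Q' * Q' = 1 := by rw [hsq, hQ2]; simp
  have hanti' : P' * Q' = -(Q' * P') := by rw [hsq, hsq, hanti]; simp
  have hr : (r (Fin.last m)).1 = 1 := by
    by_contra hne
    have h0 : (r (Fin.last m)).1 = 0 := (eq_zero_or_eq_one _).resolve_right hne
    refine mul_ne_mul_of_anticommute hP2' hQ2' hanti' ?_
    have := pauli_commute_single h0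
    rcases hP' with h | h <;> rcases hQ' with h' | h' <;>
      simp only [h, h', this, mul_neg, neg_mul, neg_neg]
  obtain ⟨g, hg, hgZ, d, hd⟩ := exists_realized_eq_single hr
  obtain ⟨V, hV, hVp⟩ := hg.exists_conj
  have hP'' := hVp P' _ hP'
  have hQ'' := hVp Q' r hQ'
  rw [hgZ, pauli_single, pauli1_zero_one] at hP''
  rw [hd] at hQ''
  have hd0 : d = 0 := eq_zero_of_pauli_single_sq hQ'' (by rw [hsq, hQ2']; simp)
  subst hd0
  rw [pauli_single, pauli1_one_zero] at hQ''
  obtain ⟨W, hW, hWP, hWQ⟩ := exists_conj_fix_signs (Fin.last m) hP'' hQ''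
  refine ⟨W * (V * U), mul_mem hW (mul_mem hV hU), ?_, ?_⟩
  · rw [lastZ_eq, ← hWP, hP'def]
    simp only [_root_.mul_inv_rev, Units.val_mul, mul_assoc]
  · rw [lastX_eq, ← hWQ, hQ'def]
    simp only [_root_.mul_inv_rev, Units.val_mul, mul_assoc]

end RealStab

end
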